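/- arXiv:2501.01325 — 9 statements merged into one kernel-verified Lean document; each statement's English description precedes it below -/
import Mathlib

section
/- Let Q₁,…,Q_d ∈ M_m(ℂ) and T₁,…,T_d ∈ M_k(ℂ). For n ≥ 1 set a_n = ‖Σ_{|w|=n} T^w ⊗ (Q_{w₁} ⊗ Q_{w₂} ⊗ ⋯ ⊗ Q_{wₙ})‖, where the sum is over all words w = w₁⋯wₙ in the letters {1,…,d}, T^w = T_{w₁}⋯T_{wₙ}, ⊗ denotes the Kronecker product of matrices, and ‖·‖ is the operator norm. Then the sequence (a_n) is submultiplicative, i.e. a_{p+q} ≤ a_p · a_q for all p, q ≥ 1, and consequently the limit lim_{n→∞} a_n^{1/n} exists and equals inf_{n≥1} a_n^{1/n}. -/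
open scoped Matrix Kronecker
open Filter Topology

/-- The operator norm of a square complex matrix, viewed as a linear operator on
Euclidean space (largest singular value). -/
noncomputable def opNorm {ι : Type*} [Fintype ι] [DecidableEq ι] (X : Matrix ι ι ℂ) : ℝ :=
  ‖Matrix.toEuclideanCLM (𝕜 := ℂ) X‖

/-- For a word `w = w₁⋯wₙ`, the ordered product `T_{w₁} T_{w₂} ⋯ T_{wₙ}`. -/
def wordProd {M : Type*} [Monoid M] {d n : ℕ} (T : Fin d → M) (w : Fin n → Fin d) : M :=
  (List.ofFn fun i => T (w i)).prod

/-- For a word `w = w₁⋯wₙ`, the iterated Kronecker product `Q_{w₁} ⊗ Q_{w₂} ⊗ ⋯ ⊗ Q_{wₙ}`,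
realized as a matrix indexed by functions `Fin n → Fin m`. -/
noncomputable def kronPow {d m n : ℕ} (Q : Fin d → Matrix (Fin m) (Fin m) ℂ)
    (w : Fin n → Fin d) : Matrix (Fin n → Fin m) (Fin n → Fin m) ℂ :=
  Matrix.of fun x y => ∏ i, Q (w i) (x i) (y i)

/-- The *-homomorphism `X ↦ X ⊗ 1`, followed by a relabelling of the index set. -/
def kroneckerOneHom {ι κ σ : Type*} [Fintype ι] [Fintype κ] [Fintype σ] [DecidableEq κ]
    (e : σ ≃ ι × κ) : Matrix ι ι ℂ →⋆ₙₐ[ℂ] Matrix σ σ ℂ where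
  toFun X := (X ⊗ₖ (1 : Matrix κ κ ℂ)).submatrix e e
  map_smul' c X := by simp [Matrix.smul_kronecker, Matrix.submatrix_smul]
  map_zero' := by simp
  map_add' X Y := by simp [Matrix.add_kronecker, Matrix.submatrix_add]
  map_mul' X Y := by
    rw [Matrix.submatrix_mul_equiv, ← Matrix.mul_kronecker_mul, one_mul]
  map_star' X := by
    simp [Matrix.star_eq_conjTranspose, Matrix.conjTranspose_kronecker]

open scoped Matrix.Norms.L2Operator in
theorem opNorm_kroneckerOneHom_le {ι κ σ : Type*} [Fintype ι] [Fintype κ] [Fintype σ]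
    [DecidableEq ι] [DecidableEq κ] [DecidableEq σ] (e : σ ≃ ι × κ) (X : Matrix ι ι ℂ) :
    opNorm (kroneckerOneHom e X) ≤ opNorm X :=
  NonUnitalStarAlgHom.norm_apply_le (kroneckerOneHom e) X

theorem opNorm_nonneg {ι : Type*} [Fintype ι] [DecidableEq ι] (X : Matrix ι ι ℂ) :
    0 ≤ opNorm X :=
  norm_nonneg _

theorem opNorm_mul_le {ι : Type*} [Fintype ι] [DecidableEq ι] (X Y : Matrix ι ι ℂ) :
    opNorm (X * Y) ≤ opNorm X * opNorm Y := by
  unfold opNorm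
  rw [map_mul]
  exact norm_mul_le _ _

theorem wordProd_append {M : Type*} [Monoid M] {d p q : ℕ} (T : Fin d → M)
    (u : Fin p → Fin d) (v : Fin q → Fin d) :
    wordProd T (Fin.append u v) = wordProd T u * wordProd T v := by
  change (List.ofFn (T ∘ Fin.append u v)).prod = (List.ofFn (T ∘ u)).prod * (List.ofFn (T ∘ v)).prod
  simp only [← List.map_ofFn, List.ofFn_fin_append, List.map_append, List.prod_append]

theorem kronPow_append {d m p q : ℕ} (Q : Fin d → Matrix (Fin m) (Fin m) ℂ)
    (u : Fin p → Fin d) (v : Fin q → Fin d) :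
    kronPow Q (Fin.append u v) = (kronPow Q u ⊗ₖ kronPow Q v).submatrix
      (Fin.appendEquiv p q).symm (Fin.appendEquiv p q).symm := by
  ext x y
  simp [kronPow, Fin.prod_univ_add, Fin.appendEquiv]

/-- Regroup the index set, splitting off the last `q` tensor factors. -/
def splitLast (k m p q : ℕ) :
    Fin k × (Fin (p + q) → Fin m) ≃ (Fin k × (Fin p → Fin m)) × (Fin q → Fin m) :=
  ((Equiv.refl _).prodCongr (Fin.appendEquiv p q).symm).trans (Equiv.prodAssoc _ _ _).symm

/-- Regroup the index set, splitting off the first `p` of the `p + q` tensor factors. -/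
def splitFirst (k m p q : ℕ) :
    Fin k × (Fin (p + q) → Fin m) ≃ (Fin k × (Fin q → Fin m)) × (Fin p → Fin m) :=
  ((Equiv.refl _).prodCongr ((Fin.appendEquiv p q).symm.trans (Equiv.prodComm _ _))).trans
    (Equiv.prodAssoc _ _ _).symm

theorem wordProd_kronecker_kronPow_append {d m k p q : ℕ}
    (Q : Fin d → Matrix (Fin m) (Fin m) ℂ) (T : Fin d → Matrix (Fin k) (Fin k) ℂ)
    (u : Fin p → Fin d) (v : Fin q → Fin d) :
    wordProd T (Fin.append u v) ⊗ₖ kronPow Q (Fin.append u v) =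
      kroneckerOneHom (splitLast k m p q) (wordProd T u ⊗ₖ kronPow Q u) *
        kroneckerOneHom (splitFirst k m p q) (wordProd T v ⊗ₖ kronPow Q v) := by
  let e := (Equiv.refl (Fin k)).prodCongr (Fin.appendEquiv (α := Fin m) p q).symm
  have h₁ : kroneckerOneHom (splitLast k m p q) (wordProd T u ⊗ₖ kronPow Q u) =
      (wordProd T u ⊗ₖ (kronPow Q u ⊗ₖ (1 : Matrix (Fin q → Fin m) (Fin q → Fin m) ℂ))).submatrix
        e e := by
    ext x y
    exact mul_assoc _ _ _
  have h₂ : kroneckerOneHom (splitFirst k m p q) (wordProd T v ⊗ₖ kronPow Q v) =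
      (wordProd T v ⊗ₖ ((1 : Matrix (Fin p → Fin m) (Fin p → Fin m) ℂ) ⊗ₖ kronPow Q v)).submatrix
        e e := by
    ext x y
    exact (mul_assoc _ _ _).trans (congrArg _ (mul_comm _ _))
  rw [h₁, h₂, Matrix.submatrix_mul_equiv, ← Matrix.mul_kronecker_mul, ← Matrix.mul_kronecker_mul,
    mul_one, one_mul, wordProd_append, kronPow_append]
  rfl

theorem sum_words_add {d m k : ℕ} (p q : ℕ)
    (Q : Fin d → Matrix (Fin m) (Fin m) ℂ) (T : Fin d → Matrix (Fin k) (Fin k) ℂ) :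
    ∑ w : Fin (p + q) → Fin d, wordProd T w ⊗ₖ kronPow Q w =
      kroneckerOneHom (splitLast k m p q) (∑ w : Fin p → Fin d, wordProd T w ⊗ₖ kronPow Q w) *
        kroneckerOneHom (splitFirst k m p q)
          (∑ w : Fin q → Fin d, wordProd T w ⊗ₖ kronPow Q w) := by
  rw [map_sum, map_sum, Finset.sum_mul_sum, ← Fintype.sum_prod_type',
    ← (Fin.appendEquiv p q).sum_comp]
  exact Finset.sum_congr rfl fun w _ => wordProd_kronecker_kronPow_append Q T w.1 w.2

/-- The multiplicative form of Fekete's lemma, for nonnegative (possibly vanishing) sequences. -/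
theorem tendsto_rpow_one_div_of_submultiplicative {a : ℕ → ℝ} (ha : ∀ n, 0 ≤ a n)
    (hmul : ∀ p q, 1 ≤ p → 1 ≤ q → a (p + q) ≤ a p * a q) :
    Tendsto (fun n : ℕ => a n ^ ((1 : ℝ) / n)) atTop
      (𝓝 (⨅ n : {n : ℕ // 1 ≤ n}, a n ^ ((1 : ℝ) / (n : ℕ)))) := by
  have hbdd : BddBelow (Set.range fun n : {n : ℕ // 1 ≤ n} => a n ^ ((1 : ℝ) / (n : ℕ))) :=
    ⟨0, by rintro _ ⟨n, rfl⟩; exact Real.rpow_nonneg (ha _) _⟩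
  have : Nonempty {n : ℕ // 1 ≤ n} := ⟨⟨1, le_rfl⟩⟩
  rw [tendsto_order]
  refine ⟨fun c hc => ?_, fun c hc => ?_⟩
  · filter_upwards [eventually_ge_atTop 1] with n hn
    exact hc.trans_le (ciInf_le hbdd ⟨n, hn⟩)
  obtain ⟨⟨n, hn⟩, hnc⟩ := exists_lt_of_ciInf_lt hc
  have hc₀ : 0 < c := (Real.rpow_nonneg (ha n) _).trans_lt hnc
  have root_lt (p : ℕ) (hp : 1 ≤ p) : a p ^ ((1 : ℝ) / p) < c ↔ a p < c ^ p := by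
    rw [one_div, Real.rpow_inv_lt_iff_of_pos (ha p) hc₀.le (by positivity), Real.rpow_natCast]
  -- Truncating below by a geometric sequence makes all terms positive.
  let b : ℕ → ℝ := fun p => if p = 0 then 1 else max (a p) ((c / 2) ^ p)
  have hb (p : ℕ) : 0 < b p := by
    dsimp only [b]
    split_ifs
    · exact one_pos
    · exact lt_max_of_lt_right (by positivity)
  have hbmul (p q : ℕ) : b (p + q) ≤ b p * b q := by
    rcases Nat.eq_zero_or_pos p with rfl | hp
    · simp [b]
    rcases Nat.eq_zero_or_pos q with rfl | hq
    · simp [b]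
    simp only [b, hp.ne', hq.ne', (Nat.add_pos_left hp q).ne', if_false]
    refine max_le ((hmul p q hp hq).trans ?_) ((pow_add _ _ _).trans_le ?_)
    · exact mul_le_mul (le_max_left _ _) (le_max_left _ _) (ha q) ((ha p).trans (le_max_left _ _))
    · exact mul_le_mul (le_max_right _ _) (le_max_right _ _) (by positivity)
        ((ha p).trans (le_max_left _ _))
  have hsub : Subadditive fun p => Real.log (b p) := fun p q => by
    rw [← Real.log_mul (hb p).ne' (hb q).ne']
    exact Real.log_le_log (hb _) (hbmul p q)
  have log_lt (p : ℕ) (hp : 1 ≤ p) : Real.log (b p) / p < Real.log c ↔ a p < c ^ p := by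
    rw [div_lt_iff₀ (by positivity), mul_comm, ← Real.log_pow,
      Real.log_lt_log_iff (hb p) (by positivity)]
    simp only [b, (Nat.one_le_iff_ne_zero.mp hp), if_false, max_lt_iff, and_iff_left_iff_imp]
    exact fun _ => pow_lt_pow_left₀ (half_lt_self hc₀) (by positivity) (by omega)
  filter_upwards [eventually_ge_atTop 1, hsub.eventually_div_lt_of_div_lt (by omega)
    ((log_lt n hn).2 ((root_lt n hn).1 hnc))] with p hp hpc
  exact (root_lt p hp).2 ((log_lt p hp).1 hpc)

/-- The sequence `a_n = ‖Σ_{|w|=n} T^w ⊗ Q_{w₁} ⊗ ⋯ ⊗ Q_{wₙ}‖` is submultiplicative,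
and consequently `a_n^{1/n}` converges to `inf_{n ≥ 1} a_n^{1/n}`. -/
theorem submultiplicative_and_limit (d m k : ℕ)
    (Q : Fin d → Matrix (Fin m) (Fin m) ℂ) (T : Fin d → Matrix (Fin k) (Fin k) ℂ) :
    (∀ p q : ℕ, 1 ≤ p → 1 ≤ q →
      opNorm (∑ w : Fin (p + q) → Fin d, (wordProd T w) ⊗ₖ (kronPow Q w))
        ≤ opNorm (∑ w : Fin p → Fin d, (wordProd T w) ⊗ₖ (kronPow Q w))
          * opNorm (∑ w : Fin q → Fin d, (wordProd T w) ⊗ₖ (kronPow Q w))) ∧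
    Tendsto
      (fun n : ℕ =>
        opNorm (∑ w : Fin n → Fin d, (wordProd T w) ⊗ₖ (kronPow Q w)) ^ ((1 : ℝ) / n))
      atTop
      (𝓝 (⨅ n : {n : ℕ // 1 ≤ n},
        opNorm (∑ w : Fin (n : ℕ) → Fin d, (wordProd T w) ⊗ₖ (kronPow Q w))
          ^ ((1 : ℝ) / (n : ℕ)))) := by
  have hmul (p q : ℕ) := calc
    opNorm (∑ w : Fin (p + q) → Fin d, (wordProd T w) ⊗ₖ (kronPow Q w))
      ≤ _ := (congrArg opNorm (sum_words_add p q Q T)).trans_le (opNorm_mul_le _ _)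
    _ ≤ opNorm (∑ w : Fin p → Fin d, (wordProd T w) ⊗ₖ (kronPow Q w))
          * opNorm (∑ w : Fin q → Fin d, (wordProd T w) ⊗ₖ (kronPow Q w)) :=
      mul_le_mul (opNorm_kroneckerOneHom_le _ _) (opNorm_kroneckerOneHom_le _ _)
        (opNorm_nonneg _) (opNorm_nonneg _)
  exact ⟨fun p q _ _ => hmul p q, tendsto_rpow_one_div_of_submultiplicative
    (a := fun n => opNorm (∑ w : Fin n → Fin d, (wordProd T w) ⊗ₖ (kronPow Q w)))
    (fun _ => opNorm_nonneg _) fun p q _ _ => hmul p q⟩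
end

section
/- Let K be a complex Hilbert space and T = (T₁,…,T_d) a d-tuple of bounded operators on K. Define the joint spectral radius ρ(T) = lim_{n→∞} ‖Σ_{|w|=n} T^w (T^w)^*‖^{1/(2n)} (the limit exists, and equals the infimum of the same quantities). Then ρ(T) < 1 if and only if there exists an invertible bounded operator S on K (with bounded inverse) such that ‖Σ_{j=1}^d (S⁻¹T_jS)(S⁻¹T_jS)^*‖ < 1, i.e. T is jointly similar to a strict row contraction. -/
open Filter Topology ContinuousLinearMap

/-- The joint (row) spectral radius `ρ(T) = lim_n ‖Σ_{|w|=n} T^w (T^w)^*‖^{1/2n}` of a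
`d`-tuple of bounded operators on a Hilbert space, expressed as the infimum over `n ≥ 1`
(the limit exists and equals this infimum). -/
noncomputable def rowSpecRad {K : Type*} [NormedAddCommGroup K] [InnerProductSpace ℂ K]
    [CompleteSpace K] {d : ℕ} (T : Fin d → K →L[ℂ] K) : ℝ :=
  ⨅ n : {n : ℕ // 1 ≤ n},
    ‖∑ w : Fin (n : ℕ) → Fin d, wordProd T w * adjoint (wordProd T w)‖
      ^ ((1 : ℝ) / (2 * (n : ℕ)))

/-- A nonnegative submultiplicative sequence `a` satisfies
`a n ^ (1 / 2n) → ⨅ n ≥ 1, a n ^ (1 / 2n)` (Fekete's lemma). -/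
theorem tendsto_rpow_iInf_of_submultiplicative {a : ℕ → ℝ} (h0 : ∀ n, 0 ≤ a n)
    (hmul : ∀ m n, a (m + n) ≤ a m * a n) :
    Tendsto (fun n : ℕ => a n ^ ((1 : ℝ) / (2 * n))) atTop
      (𝓝 (⨅ n : {n : ℕ // 1 ≤ n}, a n ^ ((1 : ℝ) / (2 * (n : ℕ))))) := by
  have hbdd : BddBelow (Set.range fun n : {n : ℕ // 1 ≤ n} =>
      a n ^ ((1 : ℝ) / (2 * (n : ℕ)))) :=
    ⟨0, by rintro _ ⟨n, rfl⟩; exact Real.rpow_nonneg (h0 _) _⟩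
  have : Nonempty {n : ℕ // 1 ≤ n} := ⟨⟨1, le_rfl⟩⟩
  refine tendsto_order.2 ⟨fun l hl => ?_, fun u hu => ?_⟩
  · filter_upwards [eventually_ge_atTop 1] with n hn
    exact hl.trans_le (ciInf_le hbdd ⟨n, hn⟩)
  obtain ⟨⟨n, hn⟩, hnu⟩ := exists_lt_of_ciInf_lt hu
  have hu0 : 0 < u := (Real.rpow_nonneg (h0 _) _).trans_lt hnu
  by_cases hz : ∃ k, a k = 0
  · obtain ⟨k, hk⟩ := hz
    filter_upwards [eventually_ge_atTop (k + 1)] with p hp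
    have hp0 : a p = 0 := by
      refine le_antisymm ?_ (h0 p)
      have := hmul k (p - k)
      rwa [hk, zero_mul, Nat.add_sub_cancel' (by omega)] at this
    have : (1 : ℝ) / (2 * p) ≠ 0 := by
      have : (0 : ℝ) < p := by exact_mod_cast (by omega : 0 < p)
      positivity
    rwa [hp0, Real.zero_rpow this]
  push Not at hz
  have hpos : ∀ k, 0 < a k := fun k => (h0 k).lt_of_ne' (hz k)
  have key : ∀ p : ℕ, 1 ≤ p →
      (a p ^ ((1 : ℝ) / (2 * p)) < u ↔ Real.log (a p) / p < 2 * Real.log u) := by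
    intro p hp
    have hp' : (0 : ℝ) < p := by exact_mod_cast hp
    rw [← Real.log_lt_log_iff (Real.rpow_pos_of_pos (hpos p) _) hu0, Real.log_rpow (hpos p),
      show 1 / (2 * (p : ℝ)) * Real.log (a p) = Real.log (a p) / p / 2 by field_simp,
      div_lt_iff₀ two_pos, mul_comm 2]
  have hsub : Subadditive fun k => Real.log (a k) := fun m k => by
    rw [← Real.log_mul (hz m) (hz k)]
    exact Real.log_le_log (hpos _) (hmul m k)
  filter_upwards [hsub.eventually_div_lt_of_div_lt (by omega) ((key n hn).1 hnu),
    eventually_ge_atTop 1] with p hp hp1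
  exact (key p hp1).2 hp

/-- The completely positive map `X ↦ ∑ j, T j * X * star (T j)` attached to a tuple `T`. -/
noncomputable def rowMap {A : Type*} [CStarAlgebra A] {d : ℕ} (T : Fin d → A) : A →ₗ[ℝ] A :=
  ∑ j, LinearMap.mulLeftRight ℝ (T j, star (T j))

section RowMap

variable {A : Type*} [CStarAlgebra A] {d : ℕ} (T : Fin d → A)

theorem rowMap_apply (X : A) : rowMap T X = ∑ j, T j * X * star (T j) := by
  simp [rowMap]

theorem sum_wordProd_mul_mul_star (n : ℕ) (X : A) :
    ∑ w : Fin n → Fin d, wordProd T w * X * star (wordProd T w) = (rowMap T ^ n) X := by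
  induction n with
  | zero => simp [wordProd]
  | succ n ih =>
    rw [pow_succ', Module.End.mul_apply, ← ih, rowMap_apply,
      ← (Fin.consEquiv fun _ => Fin d).sum_comp, Fintype.sum_prod_type]
    refine Finset.sum_congr rfl fun j _ => ?_
    rw [Finset.mul_sum, Finset.sum_mul]
    refine Finset.sum_congr rfl fun w _ => ?_
    simp [wordProd, Fin.consEquiv, List.ofFn_succ, mul_assoc]

theorem sum_similar_mul_star (S : Aˣ) :
    ∑ j, ((↑S⁻¹ : A) * T j * S) * star ((↑S⁻¹ : A) * T j * S) =
      ↑S⁻¹ * rowMap T (S * star (S : A)) * star (↑S⁻¹ : A) := by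
  simp [rowMap_apply, Finset.mul_sum, Finset.sum_mul, mul_assoc]

variable [PartialOrder A] [StarOrderedRing A]

theorem rowMap_pow_nonneg (n : ℕ) {X : A} (hX : 0 ≤ X) : 0 ≤ (rowMap T ^ n) X := by
  rw [← sum_wordProd_mul_mul_star]
  exact Finset.sum_nonneg fun w _ => star_right_conjugate_nonneg hX _

theorem rowMap_pow_mono (n : ℕ) : Monotone (rowMap T ^ n) := fun X Y h => by
  rw [← sub_nonneg, ← map_sub]
  exact rowMap_pow_nonneg T n (sub_nonneg.2 h)

theorem le_norm_smul_one {X : A} (hX : 0 ≤ X) : X ≤ ‖X‖ • (1 : A) := by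
  rw [← Algebra.algebraMap_eq_smul_one]
  exact IsSelfAdjoint.le_algebraMap_norm_self (.of_nonneg hX)

theorem norm_rowMap_pow_add_le (m n : ℕ) :
    ‖(rowMap T ^ (m + n)) 1‖ ≤ ‖(rowMap T ^ m) 1‖ * ‖(rowMap T ^ n) 1‖ := by
  have h1 : (0 : A) ≤ 1 := zero_le_one
  have h := rowMap_pow_mono T m (le_norm_smul_one (rowMap_pow_nonneg T n h1))
  rw [← Module.End.mul_apply, ← pow_add, map_smul] at h
  refine (CStarAlgebra.norm_le_norm_of_nonneg_of_le (rowMap_pow_nonneg T _ h1) h).trans ?_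
  rw [norm_smul, norm_norm, mul_comm]

/-- If `P ≥ 1` satisfies `rowMap T P ≤ r P` with `r < 1`, then conjugating by `P ^ (1/2)` turns
`T` into a strict row contraction. -/
theorem exists_similar_of_rowMap_le {P : A} (hP : 1 ≤ P) {r : ℝ} (hr0 : 0 ≤ r) (hr : r < 1)
    (h : rowMap T P ≤ r • P) :
    ∃ S : Aˣ, ‖∑ j, ((↑S⁻¹ : A) * T j * S) * star ((↑S⁻¹ : A) * T j * S)‖ < 1 := by
  have hP0 : (0 : A) ≤ P := zero_le_one.trans hP
  have hPu : IsUnit P := CStarAlgebra.isUnit_of_le (1 : A) hP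
  obtain ⟨S, hS⟩ := (CFC.isUnit_sqrt_iff P hP0).2 hPu
  have hSS : (S : A) * star (S : A) = P := by
    rw [hS, (IsSelfAdjoint.of_nonneg (CFC.sqrt_nonneg P)).star_eq, CFC.sqrt_mul_sqrt_self P hP0]
  refine ⟨S, lt_of_le_of_lt ?_ hr⟩
  have hle := star_right_conjugate_le_conjugate h (↑S⁻¹ : A)
  have hone : (↑S⁻¹ : A) * (S * star (S : A)) * star (↑S⁻¹ : A) = 1 := by
    rw [← mul_assoc, Units.inv_mul, one_mul, ← star_mul, Units.inv_mul, star_one]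
  have hnn : 0 ≤ ∑ j, ((↑S⁻¹ : A) * T j * S) * star ((↑S⁻¹ : A) * T j * S) :=
    Finset.sum_nonneg fun j _ => mul_star_self_nonneg _
  rw [CStarAlgebra.norm_le_iff_le_algebraMap _ hr0 hnn, sum_similar_mul_star, hSS,
    Algebra.algebraMap_eq_smul_one]
  rwa [mul_smul_comm, smul_mul_assoc, ← hSS, hone, hSS] at hle

theorem exists_similar_of_norm_rowMap_pow_lt_one {n : ℕ} (hn : n ≠ 0)
    (h : ‖(rowMap T ^ n) 1‖ < 1) :
    ∃ S : Aˣ, ‖∑ j, ((↑S⁻¹ : A) * T j * S) * star ((↑S⁻¹ : A) * T j * S)‖ < 1 := by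
  have h1 : (0 : A) ≤ 1 := zero_le_one
  obtain ⟨r, hr0, hr1, hr⟩ : ∃ r : ℝ, 0 < r ∧ r < 1 ∧ ‖(rowMap T ^ n) 1‖ ≤ r ^ n := by
    have hcont : Tendsto (fun r : ℝ => r ^ n) (𝓝[<] 1) (𝓝 1) := by
      simpa using ((continuous_pow n).tendsto (1 : ℝ)).mono_left nhdsWithin_le_nhds
    obtain ⟨r, hr, hr'⟩ := ((hcont.eventually_const_lt h).and
      (Ioo_mem_nhdsLT (zero_lt_one' ℝ))).exists
    exact ⟨r, hr'.1, hr'.2, hr.le⟩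
  set f : ℕ → A := fun k => (r⁻¹) ^ k • (rowMap T ^ k) 1 with hf
  have hf0 : f 0 = 1 := by simp [hf]
  have hfn : f n ≤ 1 := by
    have := (le_norm_smul_one (rowMap_pow_nonneg T n h1)).trans
      (smul_le_smul_of_nonneg_right hr h1)
    calc f n ≤ r⁻¹ ^ n • (r ^ n • (1 : A)) := smul_le_smul_of_nonneg_left this (by positivity)
      _ = 1 := by rw [smul_smul, ← mul_pow, inv_mul_cancel₀ hr0.ne', one_pow, one_smul]
  have hfk : ∀ k, rowMap T (f k) = r • f (k + 1) := fun k => by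
    simp only [hf, map_smul, ← Module.End.mul_apply, ← pow_succ', smul_smul]
    rw [pow_succ' r⁻¹, mul_inv_cancel_left₀ hr0.ne']
  refine exists_similar_of_rowMap_le T (P := ∑ k ∈ Finset.range n, f k) ?_ hr0.le hr1 ?_
  · rw [← hf0]
    exact Finset.single_le_sum (f := f)
      (fun k _ => smul_nonneg (by positivity) (rowMap_pow_nonneg T k h1))
      (Finset.mem_range.2 (Nat.pos_of_ne_zero hn))
  · rw [map_sum, Finset.sum_congr rfl fun k _ => hfk k, ← Finset.smul_sum]
    refine smul_le_smul_of_nonneg_left ?_ hr0.le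
    have hsum := (Finset.sum_range_succ' f n).symm.trans (Finset.sum_range_succ f n)
    rw [hf0] at hsum
    rw [← add_le_add_iff_right (1 : A), hsum]
    gcongr

theorem tendsto_norm_rowMap_pow_of_similar (S : Aˣ)
    (h : ‖∑ j, ((↑S⁻¹ : A) * T j * S) * star ((↑S⁻¹ : A) * T j * S)‖ < 1) :
    Tendsto (fun n => ‖(rowMap T ^ n) 1‖) atTop (𝓝 0) := by
  set Q := ∑ j, ((↑S⁻¹ : A) * T j * S) * star ((↑S⁻¹ : A) * T j * S) with hQ
  have hQ0 : 0 ≤ Q := Finset.sum_nonneg fun j _ => mul_star_self_nonneg _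
  set P := (S : A) * star (S : A) with hP
  have hconj : ∀ X : A, (S : A) * (↑S⁻¹ * X * star (↑S⁻¹ : A)) * star (S : A) = X := fun X => by
    rw [← mul_assoc, ← mul_assoc, Units.mul_inv, one_mul, mul_assoc, ← star_mul, Units.mul_inv,
      star_one, mul_one]
  have hconj_le : ∀ X : A, 0 ≤ ↑S⁻¹ * X * star (↑S⁻¹ : A) →
      X ≤ ‖↑S⁻¹ * X * star (↑S⁻¹ : A)‖ • P := fun X hX => by
    have := star_right_conjugate_le_conjugate (le_norm_smul_one hX) (S : A)
    rwa [hconj, mul_smul_comm, mul_one, smul_mul_assoc, ← hP] at this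
  have hPle : rowMap T P ≤ ‖Q‖ • P := by
    rw [hQ, sum_similar_mul_star] at hQ0 ⊢
    exact hconj_le _ hQ0
  have hPn : ∀ n, (rowMap T ^ n) P ≤ ‖Q‖ ^ n • P := fun n => by
    induction n with
    | zero => simp
    | succ n ih =>
      have := rowMap_pow_mono T 1 ih
      rw [pow_one, map_smul] at this
      rw [pow_succ', Module.End.mul_apply, pow_succ, mul_smul]
      exact this.trans (smul_le_smul_of_nonneg_left hPle (by positivity))
  set C := ‖(↑S⁻¹ : A) * 1 * star (↑S⁻¹ : A)‖
  have hbound : ∀ n, ‖(rowMap T ^ n) 1‖ ≤ ‖Q‖ ^ n * (C * ‖P‖) := fun n => by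
    have h1 : (rowMap T ^ n) 1 ≤ C • ‖Q‖ ^ n • P := by
      have := rowMap_pow_mono T n (hconj_le 1 (star_right_conjugate_nonneg zero_le_one _))
      rw [map_smul] at this
      exact this.trans (smul_le_smul_of_nonneg_left (hPn n) (norm_nonneg _))
    refine (CStarAlgebra.norm_le_norm_of_nonneg_of_le
      (rowMap_pow_nonneg T n zero_le_one) h1).trans_eq ?_
    rw [norm_smul, norm_smul, norm_pow, norm_norm, norm_norm]
    ring
  refine squeeze_zero (fun _ => norm_nonneg _) hbound ?_
  simpa using (tendsto_pow_atTop_nhds_zero_of_lt_one (norm_nonneg Q) h).mul_const (C * ‖P‖)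

end RowMap

/-- The limit defining the joint (row) spectral radius `ρ(T)` exists (and equals the
infimum of the same quantities), and `ρ(T) < 1` iff `T` is jointly similar, via a bounded
invertible operator `S` with bounded inverse, to a strict row contraction. -/
theorem rowSpecRad_lt_one_iff_similar_row_contraction
    {K : Type*} [NormedAddCommGroup K] [InnerProductSpace ℂ K] [CompleteSpace K]
    {d : ℕ} (T : Fin d → K →L[ℂ] K) :
    Tendsto
      (fun n : ℕ =>
        ‖∑ w : Fin n → Fin d, wordProd T w * adjoint (wordProd T w)‖ ^ ((1 : ℝ) / (2 * n)))
      atTop (𝓝 (rowSpecRad T)) ∧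
    (rowSpecRad T < 1 ↔
      ∃ S : (K →L[ℂ] K)ˣ,
        ‖∑ j, (((S⁻¹ : (K →L[ℂ] K)ˣ) : K →L[ℂ] K) * T j * (S : K →L[ℂ] K))
            * adjoint (((S⁻¹ : (K →L[ℂ] K)ˣ) : K →L[ℂ] K) * T j * (S : K →L[ℂ] K))‖ < 1) := by
  have ha : ∀ n : ℕ, ∑ w : Fin n → Fin d, wordProd T w * star (wordProd T w) =
      (rowMap T ^ n) 1 := fun n => by
    simp_rw [← sum_wordProd_mul_mul_star, mul_one]
  simp only [rowSpecRad, ← star_eq_adjoint, ha]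
  have hlim := tendsto_rpow_iInf_of_submultiplicative (fun n => norm_nonneg ((rowMap T ^ n) 1))
    (norm_rowMap_pow_add_le T)
  refine ⟨hlim, fun h => ?_, fun ⟨S, hS⟩ => ?_⟩
  · obtain ⟨n, hn, hn1⟩ := ((hlim.eventually_lt_const h).and (eventually_ge_atTop 1)).exists
    have hn0 : (0 : ℝ) < n := by exact_mod_cast hn1
    refine exists_similar_of_norm_rowMap_pow_lt_one T (n := n) (by omega) ?_
    by_contra! hge
    exact hn.not_ge (Real.one_le_rpow hge (by positivity))
  · obtain ⟨n, hn, hn1⟩ := (((tendsto_norm_rowMap_pow_of_similar T S hS).eventually_lt_const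
      one_pos).and (eventually_ge_atTop 1)).exists
    have hn0 : (0 : ℝ) < n := by exact_mod_cast hn1
    refine (ciInf_le ⟨0, ?_⟩ (⟨n, hn1⟩ : {n : ℕ // 1 ≤ n})).trans_lt
      (Real.rpow_lt_one (norm_nonneg _) hn (by positivity))
    rintro _ ⟨m, rfl⟩
    exact Real.rpow_nonneg (norm_nonneg _) _
end

section
/- Let X = (X₁,…,X_d) be a d-tuple of n×n complex matrices that is irreducible, meaning that the only subspaces of ℂⁿ invariant under all X₁,…,X_d are {0} and ℂⁿ. Then the infimum inf{ ‖Σ_{j=1}^d (S⁻¹X_jS)(S⁻¹X_jS)^*‖^{1/2} : S ∈ GLₙ(ℂ) } is attained at some invertible matrix S. -/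
open scoped Matrix

open ContinuousLinearMap in
/-- A row of operators has `‖∑ A_j A_j†‖ ≤ c` exactly when its adjoint column is bounded by `c`. -/
theorem norm_sum_mul_star_le_iff {E ι : Type*} [NormedAddCommGroup E] [InnerProductSpace ℂ E]
    [CompleteSpace E] [Fintype ι] (A : ι → E →L[ℂ] E) {c : ℝ} (hc : 0 ≤ c) :
    ‖∑ j, A j * star (A j)‖ ≤ c ↔ ∀ v, ∑ j, ‖star (A j) v‖ ^ 2 ≤ c * ‖v‖ ^ 2 := by
  have key (v : E) : (inner ℂ ((∑ j, A j * star (A j)) v) v : ℂ)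
      = ((∑ j, ‖star (A j) v‖ ^ 2 : ℝ) : ℂ) := by
    simp only [sum_apply, mul_apply_eq_comp, sum_inner, Complex.ofReal_sum]
    refine Finset.sum_congr rfl fun j _ => ?_
    rw [← adjoint_inner_right (A j), ← star_eq_adjoint, inner_self_eq_norm_sq_to_K]
    push_cast
    rfl
  have hnonneg : 0 ≤ ∑ j, A j * star (A j) :=
    Finset.sum_nonneg fun j _ => mul_star_self_nonneg (A j)
  rw [CStarAlgebra.norm_le_iff_le_algebraMap _ hc hnonneg, le_def, isPositive_iff_complex]
  refine forall_congr' fun v => ?_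
  have hval : (inner ℂ ((algebraMap ℝ (E →L[ℂ] E) c - ∑ j, A j * star (A j)) v) v : ℂ)
      = ((c * ‖v‖ ^ 2 - ∑ j, ‖star (A j) v‖ ^ 2 : ℝ) : ℂ) := by
    rw [sub_apply, inner_sub_left, key, Algebra.algebraMap_eq_smul_one, smul_apply, one_apply_eq_self,
      inner_smul_left_eq_star_smul, inner_self_eq_norm_sq_to_K]
    simp
  rw [hval]
  simp only [RCLike.re_eq_complex_re, Complex.ofReal_re, true_and, sub_nonneg]

/-- For a similarity, the bound of `norm_sum_mul_star_le_iff` can be stated without inverses. -/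
theorem norm_sum_similarity_le_iff {E ι : Type*} [NormedAddCommGroup E] [InnerProductSpace ℂ E]
    [CompleteSpace E] [Fintype ι] (X : ι → E →L[ℂ] E) (S : (E →L[ℂ] E)ˣ) {c : ℝ} (hc : 0 ≤ c) :
    ‖∑ j, (↑S⁻¹ * X j * (S : E →L[ℂ] E)) * star (↑S⁻¹ * X j * (S : E →L[ℂ] E))‖ ≤ c ↔
      ∀ w, ∑ j, ‖star (S : E →L[ℂ] E) (star (X j) w)‖ ^ 2
        ≤ c * ‖star (S : E →L[ℂ] E) w‖ ^ 2 := by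
  rw [norm_sum_mul_star_le_iff _ hc]
  have h1 (w : E) : star (↑S⁻¹ : E →L[ℂ] E) (star (S : E →L[ℂ] E) w) = w := by
    rw [← mul_apply_eq_comp, ← star_mul, Units.mul_inv, star_one]; rfl
  have h2 (w : E) : star (S : E →L[ℂ] E) (star (↑S⁻¹ : E →L[ℂ] E) w) = w := by
    rw [← mul_apply_eq_comp, ← star_mul, Units.inv_mul, star_one]; rfl
  constructor
  · intro h w
    simpa [star_mul, h1] using h (star (S : E →L[ℂ] E) w)
  · intro h v
    simpa [star_mul, h2] using h (star (↑S⁻¹ : E →L[ℂ] E) v)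

/-- If `S ≠ 0` satisfies the inverse-free inequality for an irreducible tuple, then `S` is
invertible. -/
theorem isUnit_of_irreducible_of_sum_le {E ι : Type*} [NormedAddCommGroup E]
    [InnerProductSpace ℂ E] [FiniteDimensional ℂ E] [CompleteSpace E] [Fintype ι]
    (X : ι → E →L[ℂ] E)
    (hirr : ∀ V : Submodule ℂ E, (∀ j, ∀ v ∈ V, X j v ∈ V) → V = ⊥ ∨ V = ⊤)
    {T : E →L[ℂ] E} (hT : T ≠ 0) {c : ℝ}
    (h : ∀ w, ∑ j, ‖T (star (X j) w)‖ ^ 2 ≤ c * ‖T w‖ ^ 2) : IsUnit T := by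
  have hker : ∀ j, ∀ w ∈ T.ker, star (X j) w ∈ T.ker := by
    intro j w hw
    have hw0 : T w = 0 := hw
    have hj : ‖T (star (X j) w)‖ ^ 2 ≤ 0 :=
      (Finset.single_le_sum (f := fun j => ‖T (star (X j) w)‖ ^ 2)
        (fun i _ => by positivity) (Finset.mem_univ j)).trans (by simpa [hw0] using h w)
    have : ‖T (star (X j) w)‖ = 0 := pow_eq_zero_iff two_ne_zero |>.1 (le_antisymm hj (by positivity))
    exact norm_eq_zero.1 this
  rcases hirr T.kerᗮ (fun j v hv => by
    rw [Submodule.mem_orthogonal] at hv ⊢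
    intro w hw
    rw [← ContinuousLinearMap.adjoint_inner_left]
    exact hv _ (hker j w hw)) with hV | hV
  · rw [Submodule.orthogonal_eq_bot_iff] at hV
    refine absurd ?_ hT
    ext v
    have : v ∈ T.ker := hV ▸ Submodule.mem_top
    exact this
  · rw [Submodule.orthogonal_eq_top_iff] at hV
    have hu : IsUnit (T : E →ₗ[ℂ] E) := (LinearMap.isUnit_iff_ker_eq_bot _).2 hV
    exact (MulEquiv.isUnit_map (Module.End.toContinuousLinearMap E).symm).1 hu

open Filter Topology in
/-- The optimal similarity of an irreducible tuple of operators on a finite-dimensional complex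
inner product space exists. -/
theorem exists_min_norm_sum_similarity {E ι : Type*} [NormedAddCommGroup E]
    [InnerProductSpace ℂ E] [FiniteDimensional ℂ E] [CompleteSpace E] [Fintype ι]
    (X : ι → E →L[ℂ] E)
    (hirr : ∀ V : Submodule ℂ E, (∀ j, ∀ v ∈ V, X j v ∈ V) → V = ⊥ ∨ V = ⊤) :
    ∃ S : (E →L[ℂ] E)ˣ, ∀ S' : (E →L[ℂ] E)ˣ,
      ‖∑ j, (↑S⁻¹ * X j * (S : E →L[ℂ] E)) * star (↑S⁻¹ * X j * (S : E →L[ℂ] E))‖ ≤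
      ‖∑ j, (↑S'⁻¹ * X j * (S' : E →L[ℂ] E)) * star (↑S'⁻¹ * X j * (S' : E →L[ℂ] E))‖ := by
  rcases subsingleton_or_nontrivial E with hE | hE
  · exact ⟨1, fun S' => le_of_eq (congrArg _ (Subsingleton.elim _ _))⟩
  set f : (E →L[ℂ] E)ˣ → ℝ := fun S =>
    ‖∑ j, (↑S⁻¹ * X j * (S : E →L[ℂ] E)) * star (↑S⁻¹ * X j * (S : E →L[ℂ] E))‖ with hf
  have hf0 : ∀ S, 0 ≤ f S := fun S => norm_nonneg _
  have hbdd : BddBelow (Set.range f) := ⟨0, by rintro _ ⟨S, rfl⟩; exact hf0 S⟩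
  obtain ⟨u, -, hu, hmem⟩ := exists_seq_tendsto_sInf (Set.range_nonempty f) hbdd
  choose S hS using hmem
  have hc0 : 0 ≤ sInf (Set.range f) :=
    Real.sInf_nonneg (by rintro _ ⟨S, rfl⟩; exact hf0 S)
  have hne (k : ℕ) : ‖star (S k : E →L[ℂ] E)‖ ≠ 0 := by
    rw [norm_star, norm_ne_zero_iff]; exact (S k).ne_zero
  set T : ℕ → E →L[ℂ] E := fun k =>
    ((‖star (S k : E →L[ℂ] E)‖⁻¹ : ℝ) : ℂ) • star (S k : E →L[ℂ] E) with hTdef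
  have hTnorm (k : ℕ) : ‖T k‖ = 1 := by
    simp only [hTdef, norm_smul, Complex.norm_real, norm_inv, norm_norm]
    exact inv_mul_cancel₀ (hne k)
  have hTle (k : ℕ) (w : E) : ∑ j, ‖T k (star (X j) w)‖ ^ 2 ≤ u k * ‖T k w‖ ^ 2 := by
    have h := (norm_sum_similarity_le_iff X (S k) (c := u k) (hS k ▸ hf0 _)).1 (hS k).le w
    simp only [hTdef, smul_apply, norm_smul, mul_pow]
    rw [← Finset.mul_sum, mul_left_comm]
    gcongr
  have : ProperSpace (E →L[ℂ] E) := FiniteDimensional.proper ℂ _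
  obtain ⟨L, hL, φ, hφ, hlim⟩ := (isCompact_sphere (0 : E →L[ℂ] E) 1).tendsto_subseq
    (x := T) (fun k => by simpa using hTnorm k)
  have hLle (w : E) : ∑ j, ‖L (star (X j) w)‖ ^ 2 ≤ sInf (Set.range f) * ‖L w‖ ^ 2 := by
    have happ (v : E) : Tendsto (fun k => ‖T (φ k) v‖ ^ 2) atTop (𝓝 (‖L v‖ ^ 2)) :=
      ((((ContinuousLinearMap.apply ℂ E v).continuous.tendsto L).comp hlim).norm).pow 2
    exact le_of_tendsto_of_tendsto' (tendsto_finsetSum _ fun j _ => happ (star (X j) w))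
      ((hu.comp hφ.tendsto_atTop).mul (happ w)) fun k => hTle (φ k) w
  have hL0 : L ≠ 0 := by
    rintro rfl
    simp at hL
  have hunit := (isUnit_of_irreducible_of_sum_le X hirr hL0 hLle).star
  refine ⟨hunit.unit, fun S' => ?_⟩
  refine le_trans ?_ (csInf_le hbdd ⟨S', rfl⟩)
  rw [norm_sum_similarity_le_iff X _ hc0]
  simpa using hLle

/-- If the `d`-tuple `X` of `n × n` matrices is irreducible (the only common invariant
subspaces of `X₁, …, X_d` are `{0}` and `ℂⁿ`), then the infimum
`inf { ‖Σ_j (S⁻¹X_jS)(S⁻¹X_jS)^*‖^{1/2} : S ∈ GLₙ(ℂ) }` is attained at some invertible `S`. -/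
theorem inf_similarity_attained_of_irreducible (d n : ℕ)
    (X : Fin d → Matrix (Fin n) (Fin n) ℂ)
    (hirr : ∀ V : Submodule ℂ (Fin n → ℂ),
      (∀ j, ∀ v ∈ V, (X j).mulVec v ∈ V) → V = ⊥ ∨ V = ⊤) :
    ∃ S : (Matrix (Fin n) (Fin n) ℂ)ˣ, ∀ S' : (Matrix (Fin n) (Fin n) ℂ)ˣ,
      Real.sqrt (opNorm (∑ j,
          (((S⁻¹ : (Matrix (Fin n) (Fin n) ℂ)ˣ) : Matrix (Fin n) (Fin n) ℂ) * X j
              * (S : Matrix (Fin n) (Fin n) ℂ))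
            * (((S⁻¹ : (Matrix (Fin n) (Fin n) ℂ)ˣ) : Matrix (Fin n) (Fin n) ℂ) * X j
              * (S : Matrix (Fin n) (Fin n) ℂ))ᴴ))
        ≤ Real.sqrt (opNorm (∑ j,
          (((S'⁻¹ : (Matrix (Fin n) (Fin n) ℂ)ˣ) : Matrix (Fin n) (Fin n) ℂ) * X j
              * (S' : Matrix (Fin n) (Fin n) ℂ))
            * (((S'⁻¹ : (Matrix (Fin n) (Fin n) ℂ)ˣ) : Matrix (Fin n) (Fin n) ℂ) * X j
              * (S' : Matrix (Fin n) (Fin n) ℂ))ᴴ)) := by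
  let Φ := Matrix.toEuclideanCLM (n := Fin n) (𝕜 := ℂ)
  obtain ⟨S, hS⟩ := exists_min_norm_sum_similarity (fun j => Φ (X j)) (by
    intro V hV
    let e := WithLp.linearEquiv 2 ℂ (Fin n → ℂ)
    have h := hirr (V.map e.toLinearMap) (by
      rintro j _ ⟨v, hv, rfl⟩
      exact ⟨Φ (X j) v, hV j v hv, rfl⟩)
    refine h.imp (fun h => ?_) (fun h => ?_)
    · exact (Submodule.map_eq_bot_iff (e := e)).1 h
    · exact (Submodule.map_eq_top_iff (e := e)).1 h)
  let U := Units.mapEquiv (MulEquivClass.toMulEquiv Φ)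
  have key (R : (Matrix (Fin n) (Fin n) ℂ)ˣ) :
      opNorm (∑ j, (((R⁻¹ : (Matrix (Fin n) (Fin n) ℂ)ˣ) : Matrix (Fin n) (Fin n) ℂ) * X j * R.1)
        * (((R⁻¹ : (Matrix (Fin n) (Fin n) ℂ)ˣ) : Matrix (Fin n) (Fin n) ℂ) * X j * R.1)ᴴ)
      = ‖∑ j, ((U R)⁻¹.1 * Φ (X j) * (U R).1) * star ((U R)⁻¹.1 * Φ (X j) * (U R).1)‖ := by
    have h1 : (U R).1 = Φ R.1 := rfl
    have h2 : (U R)⁻¹.1 = Φ R⁻¹.1 := rfl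
    simp only [opNorm, h1, h2, ← map_mul, ← map_star, ← map_sum, Matrix.star_eq_conjTranspose]
    rfl
  refine ⟨U.symm S, fun S' => Real.sqrt_le_sqrt ?_⟩
  rw [key, key, U.apply_symm_apply]
  exact hS (U S')
end

section
/- Let A₁ = [[1/2,0,0],[-1/2,0,0],[1/√2,0,0]], A₂ = [[0,-1/2,0],[0,1/2,0],[0,1/√2,0]] ∈ M₃(ℂ), b = (-1/√2, -1/√2, 0)ᵀ ∈ ℂ³, and c = (0,0,1)ᵀ ∈ ℂ³. Then for all z, w ∈ ℂ with z + w ≠ 2, the matrix I₃ - zA₁ - wA₂ is invertible and cᵀ (I₃ - zA₁ - wA₂)⁻¹ b = (2zw - z - w)/(2 - z - w). -/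
open scoped Matrix

/-- The matrix `A₁` of the descriptor realization of `(2zw - z - w)/(2 - z - w)`. -/
noncomputable def A₁ : Matrix (Fin 3) (Fin 3) ℂ :=
  !![1/2, 0, 0; -(1/2), 0, 0; 1/(Real.sqrt 2 : ℂ), 0, 0]

/-- The matrix `A₂` of the descriptor realization of `(2zw - z - w)/(2 - z - w)`. -/
noncomputable def A₂ : Matrix (Fin 3) (Fin 3) ℂ :=
  !![0, -(1/2), 0; 0, 1/2, 0; 0, 1/(Real.sqrt 2 : ℂ), 0]

/-- The vector `b` of the descriptor realization. -/
noncomputable def bVec : Fin 3 → ℂ :=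
  ![-(1/(Real.sqrt 2 : ℂ)), -(1/(Real.sqrt 2 : ℂ)), 0]

/-- The vector `c` of the descriptor realization. -/
noncomputable def cVec : Fin 3 → ℂ := ![0, 0, 1]

theorem pencil_eq (z w : ℂ) :
    (1 : Matrix (Fin 3) (Fin 3) ℂ) - z • A₁ - w • A₂ =
      !![1 - z / 2, w / 2, 0; z / 2, 1 - w / 2, 0;
        -(z / (Real.sqrt 2 : ℂ)), -(w / (Real.sqrt 2 : ℂ)), 1] := by
  ext i j
  fin_cases i <;> fin_cases j <;> simp [A₁, A₂] <;> ring

theorem det_pencil (z w : ℂ) :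
    ((1 : Matrix (Fin 3) (Fin 3) ℂ) - z • A₁ - w • A₂).det = (2 - z - w) / 2 := by
  rw [pencil_eq, Matrix.det_fin_three]
  simp
  ring

theorem pencil_mulVec_solution (z w : ℂ) (hD : 2 - z - w ≠ 0) :
    ((1 : Matrix (Fin 3) (Fin 3) ℂ) - z • A₁ - w • A₂) *ᵥ
      ![-(2 * (1 - w) / ((Real.sqrt 2 : ℂ) * (2 - z - w))),
        -(2 * (1 - z) / ((Real.sqrt 2 : ℂ) * (2 - z - w))),
        (2 * z * w - z - w) / (2 - z - w)] = bVec := by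
  have hs2 : (Real.sqrt 2 : ℂ) ^ 2 = 2 := by
    rw [← Complex.ofReal_pow, Real.sq_sqrt zero_le_two, Complex.ofReal_ofNat]
  have hs : (Real.sqrt 2 : ℂ) ≠ 0 := by
    rw [← pow_ne_zero_iff two_ne_zero, hs2]
    exact two_ne_zero
  rw [pencil_eq, bVec]
  generalize (Real.sqrt 2 : ℂ) = s at hs2 hs
  ext i
  fin_cases i <;> simp [Matrix.mulVec, dotProduct, Fin.sum_univ_three]
  · field_simp
    ring
  · field_simp
    ring
  · field_simp
    rw [hs2]
    ring

/-- For all `z, w ∈ ℂ` with `z + w ≠ 2`, the matrix `I₃ - zA₁ - wA₂` is invertible and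
`cᵀ (I₃ - zA₁ - wA₂)⁻¹ b = (2zw - z - w)/(2 - z - w)`. -/
theorem descriptor_realization_famous_example (z w : ℂ) (h : z + w ≠ 2) :
    IsUnit ((1 : Matrix (Fin 3) (Fin 3) ℂ) - z • A₁ - w • A₂) ∧
    cVec ⬝ᵥ (((1 : Matrix (Fin 3) (Fin 3) ℂ) - z • A₁ - w • A₂)⁻¹ *ᵥ bVec)
      = (2 * z * w - z - w) / (2 - z - w) := by
  have hD : 2 - z - w ≠ 0 := fun h0 => h (by linear_combination -h0)
  have hdet : IsUnit ((1 : Matrix (Fin 3) (Fin 3) ℂ) - z • A₁ - w • A₂).det := by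
    rw [det_pencil]
    exact (div_ne_zero hD two_ne_zero).isUnit
  refine ⟨(Matrix.isUnit_iff_isUnit_det _).2 hdet, ?_⟩
  rw [← pencil_mulVec_solution z w hD, Matrix.mulVec_mulVec, Matrix.nonsing_inv_mul _ hdet,
    Matrix.one_mulVec]
  simp [cVec, dotProduct, Fin.sum_univ_three]
end

section
/- Let A₁ = [[1/2,0,0],[-1/2,0,0],[1/√2,0,0]], A₂ = [[0,-1/2,0],[0,1/2,0],[0,1/√2,0]] ∈ M₃(ℂ), b = (-1/√2, -1/√2, 0)ᵀ ∈ ℂ³, and c = (0,0,1)ᵀ ∈ ℂ³. Then this realization is controllable and observable: the linear span of the vectors A^w b, over all (possibly empty) words w in the letters {1,2}, is all of ℂ³, and the linear span of the vectors (A^w)^* c, over all (possibly empty) words w in {1,2}, is all of ℂ³. -/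
open scoped Matrix

theorem ofReal_sqrt_two_ne_zero : (Real.sqrt 2 : ℂ) ≠ 0 := by
  simp

/-- A set containing three vectors of which every vector is a linear combination spans. -/
theorem span_eq_top_of_forall_eq_combination {K V : Type*} [Semiring K] [AddCommMonoid V]
    [Module K V] {S : Set V} {u v w : V} (hu : u ∈ S) (hv : v ∈ S) (hw : w ∈ S)
    (h : ∀ x, ∃ α β γ : K, x = α • u + β • v + γ • w) : Submodule.span K S = ⊤ := by
  refine Submodule.eq_top_iff'.2 fun x => ?_
  obtain ⟨α, β, γ, rfl⟩ := h x
  have mem {y : V} (hy : y ∈ S) (a : K) : a • y ∈ Submodule.span K S :=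
    Submodule.smul_mem _ a (Submodule.subset_span hy)
  exact add_mem (add_mem (mem hu α) (mem hv β)) (mem hw γ)

theorem ofReal_sqrt_two_mul_self : (Real.sqrt 2 : ℂ) * Real.sqrt 2 = 2 := by
  rw [← Complex.ofReal_mul, Real.mul_self_sqrt (by norm_num)]
  norm_num

theorem A₁_mulVec_bVec :
    A₁ *ᵥ bVec = ![-(1/(2 * Real.sqrt 2 : ℂ)), 1/(2 * Real.sqrt 2 : ℂ), -(1/2)] := by
  have hr := ofReal_sqrt_two_ne_zero
  ext i
  fin_cases i <;> simp [A₁, bVec, Matrix.mulVec_eq_sum, Fin.sum_univ_three] <;> field_simp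
  linear_combination -ofReal_sqrt_two_mul_self

theorem A₂_mulVec_bVec :
    A₂ *ᵥ bVec = ![1/(2 * Real.sqrt 2 : ℂ), -(1/(2 * Real.sqrt 2 : ℂ)), -(1/2)] := by
  have hr := ofReal_sqrt_two_ne_zero
  ext i
  fin_cases i <;> simp [A₂, bVec, Matrix.mulVec_eq_sum, Fin.sum_univ_three] <;> field_simp
  linear_combination -ofReal_sqrt_two_mul_self

theorem A₁_conjTranspose_mulVec_cVec : A₁ᴴ *ᵥ cVec = ![1/(Real.sqrt 2 : ℂ), 0, 0] := by
  ext i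
  fin_cases i <;>
    simp [A₁, cVec, Matrix.mulVec_eq_sum, Fin.sum_univ_three, Matrix.conjTranspose_apply]

theorem A₂_conjTranspose_mulVec_cVec : A₂ᴴ *ᵥ cVec = ![0, 1/(Real.sqrt 2 : ℂ), 0] := by
  ext i
  fin_cases i <;>
    simp [A₂, cVec, Matrix.mulVec_eq_sum, Fin.sum_univ_three, Matrix.conjTranspose_apply]

/-- The realization `(A, b, c)` is controllable and observable: the vectors `A^w b`
(over all words `w` in the letters `{1,2}`, including the empty word) span `ℂ³`, and
likewise the vectors `(A^w)^* c` span `ℂ³`. -/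
theorem realization_controllable_observable :
    Submodule.span ℂ
        {v : Fin 3 → ℂ | ∃ w : List (Fin 2), v = (w.map ![A₁, A₂]).prod *ᵥ bVec} = ⊤ ∧
    Submodule.span ℂ
        {v : Fin 3 → ℂ | ∃ w : List (Fin 2), v = ((w.map ![A₁, A₂]).prod)ᴴ *ᵥ cVec} = ⊤ := by
  have hr := ofReal_sqrt_two_ne_zero
  constructor
  · refine span_eq_top_of_forall_eq_combination (u := bVec) (v := A₁ *ᵥ bVec) (w := A₂ *ᵥ bVec)
      ⟨[], by simp⟩ ⟨[0], by simp⟩ ⟨[1], by simp⟩ fun x =>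
      ⟨-(Real.sqrt 2 * (x 0 + x 1) / 2), -x 2 - Real.sqrt 2 * (x 0 - x 1) / 2,
        -x 2 + Real.sqrt 2 * (x 0 - x 1) / 2, ?_⟩
    rw [A₁_mulVec_bVec, A₂_mulVec_bVec]
    ext i
    fin_cases i <;> simp [bVec] <;> field_simp <;> ring
  · refine span_eq_top_of_forall_eq_combination (u := cVec) (v := A₁ᴴ *ᵥ cVec)
      (w := A₂ᴴ *ᵥ cVec) ⟨[], by simp⟩ ⟨[0], by simp⟩ ⟨[1], by simp⟩ fun x =>
      ⟨x 2, Real.sqrt 2 * x 0, Real.sqrt 2 * x 1, ?_⟩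
    rw [A₁_conjTranspose_mulVec_cVec, A₂_conjTranspose_mulVec_cVec]
    ext i
    fin_cases i <;> simp [cVec] <;> field_simp
end

section
/- Let A₁ = [[1/2,0,0],[-1/2,0,0],[1/√2,0,0]], A₂ = [[0,-1/2,0],[0,1/2,0],[0,1/√2,0]] ∈ M₃(ℂ), let v₁ = (1/2, -1/2, 1/√2)ᵀ, v₂ = (-1/2, 1/2, 1/√2)ᵀ, and let e₁, e₂ be the first two standard basis vectors of ℂ³. Then for every n ≥ 1 and every word w = w₁⋯wₙ in {1,2}, A^w = (1/2^{n-1}) (-1)^{m(w)} v_{w₁} e_{wₙ}^*, where m(w) = #{ i : 1 ≤ i ≤ n-1, w_i ≠ w_{i+1} } and v e^* denotes the rank-one matrix (outer product). -/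
open scoped Matrix

/-- The vectors `v₁ = (1/2, -1/2, 1/√2)` and `v₂ = (-1/2, 1/2, 1/√2)`. -/
noncomputable def vVec : Fin 2 → Fin 3 → ℂ :=
  ![![1/2, -(1/2), 1/(Real.sqrt 2 : ℂ)], ![-(1/2), 1/2, 1/(Real.sqrt 2 : ℂ)]]

/-- The first two standard basis vectors `e₁, e₂` of `ℂ³`. -/
def eVec : Fin 2 → Fin 3 → ℂ := ![![1, 0, 0], ![0, 1, 0]]

/-- The letter matrices are the rank-one matrices `A_a = v_a e_a^*`. -/
theorem letter_eq_vecMulVec (a : Fin 2) :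
    (![A₁, A₂] : Fin 2 → Matrix (Fin 3) (Fin 3) ℂ) a
      = Matrix.vecMulVec (vVec a) (star (eVec a)) := by
  ext i j
  fin_cases a <;> fin_cases i <;> fin_cases j <;>
    simp [A₁, A₂, vVec, eVec, Matrix.vecMulVec_apply]

theorem star_eVec_dotProduct_vVec (a b : Fin 2) :
    star (eVec a) ⬝ᵥ vVec b = 1 / 2 * (if a ≠ b then -1 else 1) := by
  fin_cases a <;> fin_cases b <;>
    simp [vVec, eVec, dotProduct, Fin.sum_univ_three]

theorem wordProd_succ {M : Type*} [Monoid M] {d n : ℕ} (T : Fin d → M)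
    (w : Fin (n + 1) → Fin d) :
    wordProd T w = T (w 0) * wordProd T (fun i => w i.succ) := by
  simp [wordProd, List.ofFn_succ]

/-- For every word `w` of length `n + 1` in two letters,
`A^w = (1/2ⁿ) (-1)^{m(w)} v_{w₁} e_{wₙ₊₁}^*`, where `m(w)` is the number of indices at
which consecutive letters of `w` differ, and `v e^*` is the rank-one outer product. -/
theorem word_product_rank_one (n : ℕ) (w : Fin (n + 1) → Fin 2) :
    wordProd ![A₁, A₂] w
      = ((1 / 2 ^ n : ℂ)
            * (-1) ^ (Finset.univ.filter fun i : Fin n => w i.castSucc ≠ w i.succ).card)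
          • Matrix.vecMulVec (vVec (w 0)) (star (eVec (w (Fin.last n)))) := by
  induction n with
  | zero => simp [wordProd, letter_eq_vecMulVec]
  | succ n ih =>
    rw [wordProd_succ, ih, letter_eq_vecMulVec, Matrix.mul_smul,
      Matrix.vecMulVec_mul_vecMulVec, star_eVec_dotProduct_vVec, Matrix.vecMulVec_smul,
      smul_smul, Fin.card_filter_univ_succ]
    simp only [Fin.succ_last, Fin.castSucc_zero, ← Fin.succ_castSucc]
    congr 1
    split_ifs <;> ring
end

section
/- Let A₁ = [[1/2,0,0],[-1/2,0,0],[1/√2,0,0]], A₂ = [[0,-1/2,0],[0,1/2,0],[0,1/√2,0]] ∈ M₃(ℂ). Then for every n ≥ 2, Σ_{|w|=n} A^w = (1/2)·[[1,-1,0],[-1,1,0],[0,0,0]], where the sum is over all words w of length n in {1,2}; in particular the operator norm ‖Σ_{|w|=n} A^w‖ = 1 for all n ≥ 2. -/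
open scoped Matrix

theorem sum_wordProd_eq_pow {R : Type*} [Semiring R] {d : ℕ} (T : Fin d → R) (n : ℕ) :
    ∑ w : Fin n → Fin d, wordProd T w = (∑ i, T i) ^ n := by
  induction n with
  | zero => simp [wordProd]
  | succ n ih =>
    rw [pow_succ', ← ih, Finset.sum_mul_sum, ← Fintype.sum_prod_type',
      ← (Fin.consEquiv fun _ : Fin (n + 1) => Fin d).sum_comp]
    simp [wordProd, Fin.consEquiv, List.ofFn_succ]

theorem IsStarProjection.norm_eq_one {A : Type*} [NonUnitalNormedRing A] [StarRing A]
    [CStarRing A] {p : A} (hp : IsStarProjection p) (h0 : p ≠ 0) : ‖p‖ = 1 := by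
  have h := CStarRing.norm_star_mul_self (x := p)
  rw [hp.isSelfAdjoint.star_eq, hp.isIdempotentElem.eq] at h
  exact (mul_eq_left₀ (norm_ne_zero_iff.2 h0)).1 h.symm

/-- A nonzero orthogonal projection matrix has operator norm one. -/
theorem opNorm_eq_one_of_isStarProjection {ι : Type*} [Fintype ι] [DecidableEq ι]
    {P : Matrix ι ι ℂ} (hP : IsStarProjection P) (h0 : P ≠ 0) : opNorm P = 1 :=
  (hP.map (Matrix.toEuclideanCLM (𝕜 := ℂ) (n := ι))).norm_eq_one <| by simpa using h0

theorem A₁_add_A₂_pow {n : ℕ} (hn : 2 ≤ n) :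
    (A₁ + A₂) ^ n = (1/2 : ℂ) • !![1, -1, 0; -1, 1, 0; 0, 0, 0] := by
  induction n, hn using Nat.le_induction with
  | base =>
    rw [pow_two]
    ext i j
    fin_cases i <;> fin_cases j <;>
      simp [A₁, A₂, Matrix.mul_apply, Fin.sum_univ_three] <;> ring
  | succ n _ ih =>
    rw [pow_succ, ih]
    ext i j
    fin_cases i <;> fin_cases j <;>
      simp [A₁, A₂, Matrix.mul_apply, Fin.sum_univ_three] <;> ring

theorem isStarProjection_half_smul :
    IsStarProjection ((1/2 : ℂ) • !![1, -1, 0; -1, 1, 0; 0, 0, 0] :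
      Matrix (Fin 3) (Fin 3) ℂ) := by
  constructor
  · ext i j
    fin_cases i <;> fin_cases j <;> simp [Matrix.mul_apply, Fin.sum_univ_three] <;> ring
  · ext i j
    fin_cases i <;> fin_cases j <;> simp [Matrix.star_apply]

/-- For every `n ≥ 2`, `Σ_{|w|=n} A^w = (1/2)·[[1,-1,0],[-1,1,0],[0,0,0]]`, and in
particular `‖Σ_{|w|=n} A^w‖ = 1`. -/
theorem sum_word_products_eq (n : ℕ) (hn : 2 ≤ n) :
    (∑ w : Fin n → Fin 2, wordProd ![A₁, A₂] w)
        = (1/2 : ℂ) • !![1, -1, 0; -1, 1, 0; 0, 0, 0] ∧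
    opNorm (∑ w : Fin n → Fin 2, wordProd ![A₁, A₂] w) = 1 := by
  have h : (∑ w : Fin n → Fin 2, wordProd ![A₁, A₂] w)
      = (1/2 : ℂ) • !![1, -1, 0; -1, 1, 0; 0, 0, 0] := by
    rw [sum_wordProd_eq_pow, Fin.sum_univ_two]
    exact A₁_add_A₂_pow hn
  refine ⟨h, h ▸ opNorm_eq_one_of_isStarProjection isStarProjection_half_smul fun h0 => ?_⟩
  simpa using congr_fun (congr_fun h0 0) 0
end

section
/- Let k ≥ 1 and let Z, W ∈ M_k(ℂ) with ‖Z‖ < 1 and ‖W‖ < 1 (operator norm). Let P(Z,W) ∈ M_{2k}(ℂ) be the block matrix I_{2k} - [[Z/2, -W/2],[-Z/2, W/2]]. Then P(Z,W) is invertible, and the matrix f(Z,W) := -(1/2) [I_k, I_k] · [[Z,0],[0,W]] · P(Z,W)⁻¹ · [I_k; I_k] (where [I_k, I_k] is the 1×2 block row, [I_k; I_k] the 2×1 block column, and [[Z,0],[0,W]] the block diagonal) satisfies ‖f(Z,W)‖ ≤ 1. That is, the noncommutative lift of the rational function (2zw - z - w)/(2 - z - w) given by its Fornasini–Marchesini realization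 is defined and bounded by 1 on the noncommutative unit bidisc. -/
open scoped Matrix

/-- The block row `[I_k, I_k]`. -/
def rowII (k : ℕ) : Matrix (Fin k) (Fin k ⊕ Fin k) ℂ :=
  Matrix.of fun i j => (1 : Matrix (Fin k) (Fin k) ℂ) i (Sum.elim id id j)

/-- The block column `[I_k; I_k]`. -/
def colII (k : ℕ) : Matrix (Fin k ⊕ Fin k) (Fin k) ℂ :=
  Matrix.of fun i j => (1 : Matrix (Fin k) (Fin k) ℂ) (Sum.elim id id i) j

theorem norm_toLp_mulVec_le {ι : Type*} [Fintype ι] [DecidableEq ι] (X : Matrix ι ι ℂ)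
    (u : ι → ℂ) :
    ‖WithLp.toLp 2 (X *ᵥ u)‖ ≤ opNorm X * ‖WithLp.toLp 2 u‖ := by
  simpa [opNorm] using (Matrix.toEuclideanCLM (𝕜 := ℂ) X).le_opNorm (WithLp.toLp 2 u)

theorem rowII_mulVec (k : ℕ) (p : Fin k ⊕ Fin k → ℂ) :
    rowII k *ᵥ p = p ∘ Sum.inl + p ∘ Sum.inr := by
  have h : rowII k = Matrix.fromCols 1 1 := by
    ext i (j | j) <;> rfl
  rw [h, Matrix.fromCols_mulVec, Matrix.one_mulVec, Matrix.one_mulVec]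

theorem colII_mulVec (k : ℕ) (x : Fin k → ℂ) : colII k *ᵥ x = Sum.elim x x := by
  have h : colII k = Matrix.fromRows 1 1 := by
    ext (i | i) j <;> rfl
  rw [h, Matrix.fromRows_mulVec, Matrix.one_mulVec]

/-- The pencil `P(Z,W)` splits into two equations coupling the halves of a vector. -/
theorem pencil_mulVec_eq_iff {ι : Type*} [Fintype ι] [DecidableEq ι] (Z W : Matrix ι ι ℂ)
    (p : ι ⊕ ι → ℂ) (x : ι → ℂ) :
    ((1 : Matrix (ι ⊕ ι) (ι ⊕ ι) ℂ)
        - Matrix.fromBlocks ((1/2 : ℂ) • Z) (-((1/2 : ℂ) • W))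
            (-((1/2 : ℂ) • Z)) ((1/2 : ℂ) • W)) *ᵥ p = Sum.elim x x ↔
      p ∘ Sum.inl = x + (1/2 : ℂ) • (Z *ᵥ (p ∘ Sum.inl) - W *ᵥ (p ∘ Sum.inr)) ∧
      p ∘ Sum.inr = x - (1/2 : ℂ) • (Z *ᵥ (p ∘ Sum.inl) - W *ᵥ (p ∘ Sum.inr)) := by
  rw [Matrix.sub_mulVec, Matrix.one_mulVec, Matrix.fromBlocks_mulVec]
  simp only [Matrix.neg_mulVec, Matrix.smul_mulVec, funext_iff, Sum.forall, Pi.sub_apply,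
    Pi.add_apply, Pi.smul_apply, Pi.neg_apply, Sum.elim_inl, Sum.elim_inr, Function.comp_apply,
    smul_eq_mul]
  constructor <;> rintro ⟨h₁, h₂⟩ <;> refine ⟨fun i => ?_, fun i => ?_⟩
  · linear_combination h₁ i
  · linear_combination h₂ i
  · linear_combination h₁ i
  · linear_combination h₂ i

/-- If `u, v = x ± (a - b)/2` with `‖a‖ ≤ ‖u‖` and `‖b‖ ≤ ‖v‖`, the parallelogram law bounds
the mean of `a` and `b` by `x`. -/
theorem norm_half_add_le_of_norm_le {E : Type*} [NormedAddCommGroup E] [InnerProductSpace ℂ E]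
    {x a b : E} (ha : ‖a‖ ≤ ‖x + (1/2 : ℂ) • (a - b)‖) (hb : ‖b‖ ≤ ‖x - (1/2 : ℂ) • (a - b)‖) :
    ‖(1/2 : ℂ) • (a + b)‖ ≤ ‖x‖ := by
  have h₁ := parallelogram_law_with_norm ℂ x ((1/2 : ℂ) • (a - b))
  have h₂ := parallelogram_law_with_norm ℂ ((1/2 : ℂ) • (a + b)) ((1/2 : ℂ) • (a - b))
  have e₁ : (1/2 : ℂ) • (a + b) + (1/2 : ℂ) • (a - b) = a := by module
  have e₂ : (1/2 : ℂ) • (a + b) - (1/2 : ℂ) • (a - b) = b := by module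
  rw [e₁, e₂] at h₂
  have ha' := mul_self_le_mul_self (norm_nonneg a) ha
  have hb' := mul_self_le_mul_self (norm_nonneg b) hb
  exact abs_le_of_sq_le_sq' (by nlinarith) (norm_nonneg x) |>.2

theorem isUnit_pencil {ι : Type*} [Fintype ι] [DecidableEq ι] {Z W : Matrix ι ι ℂ}
    (hZ : opNorm Z < 1) (hW : opNorm W < 1) :
    IsUnit ((1 : Matrix (ι ⊕ ι) (ι ⊕ ι) ℂ)
        - Matrix.fromBlocks ((1/2 : ℂ) • Z) (-((1/2 : ℂ) • W))
            (-((1/2 : ℂ) • Z)) ((1/2 : ℂ) • W)) := by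
  rw [← Matrix.mulVec_injective_iff_isUnit, ← Matrix.coe_mulVecLin,
    injective_iff_map_eq_zero]
  intro p hp
  rw [Matrix.mulVecLin_apply, ← Sum.elim_zero_zero, pencil_mulVec_eq_iff] at hp
  obtain ⟨h₁, h₂⟩ := hp
  set u := p ∘ Sum.inl with hu
  set v := p ∘ Sum.inr with hv
  have hvu : v = -u := by linear_combination h₁ + h₂
  rw [hvu, Matrix.mulVec_neg, zero_add, sub_neg_eq_add] at h₁
  have hle : ‖WithLp.toLp 2 u‖ ≤ (opNorm Z + opNorm W) / 2 * ‖WithLp.toLp 2 u‖ := by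
    calc ‖WithLp.toLp 2 u‖
        = ‖(1/2 : ℂ) • (WithLp.toLp 2 (Z *ᵥ u) + WithLp.toLp 2 (W *ᵥ u))‖ := by
          rw [← WithLp.toLp_add, ← WithLp.toLp_smul, ← h₁]
      _ ≤ 1/2 * (‖WithLp.toLp 2 (Z *ᵥ u)‖ + ‖WithLp.toLp 2 (W *ᵥ u)‖) := by
          rw [norm_smul]
          norm_num
          exact norm_add_le _ _
      _ ≤ (opNorm Z + opNorm W) / 2 * ‖WithLp.toLp 2 u‖ := by
          linarith [norm_toLp_mulVec_le Z u, norm_toLp_mulVec_le W u]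
  have hu₀ : u = 0 := by
    have : ‖WithLp.toLp 2 u‖ = 0 := by nlinarith [norm_nonneg (WithLp.toLp 2 u)]
    simpa using this
  have hv₀ : v = 0 := by rw [hvu, hu₀, neg_zero]
  rw [← Sum.elim_comp_inl_inr p, ← hu, ← hv, hu₀, hv₀, Sum.elim_zero_zero]

/-- The Fornasini–Marchesini lift of the ``famous example'' `(2zw - z - w)/(2 - z - w)`
is defined and bounded by `1` on the noncommutative unit bidisc: for `‖Z‖ < 1` and
`‖W‖ < 1`, the pencil `P(Z,W) = I - [[Z/2, -W/2],[-Z/2, W/2]]` is invertible and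
`‖-(1/2)[I,I]·diag(Z,W)·P(Z,W)⁻¹·[I;I]‖ ≤ 1`. -/
theorem fm_realization_bounded_on_bidisc (k : ℕ) (Z W : Matrix (Fin k) (Fin k) ℂ)
    (hZ : opNorm Z < 1) (hW : opNorm W < 1) :
    IsUnit ((1 : Matrix (Fin k ⊕ Fin k) (Fin k ⊕ Fin k) ℂ)
        - Matrix.fromBlocks ((1/2 : ℂ) • Z) (-((1/2 : ℂ) • W))
            (-((1/2 : ℂ) • Z)) ((1/2 : ℂ) • W)) ∧
    opNorm ((-(1/2 : ℂ)) •
        (rowII k * Matrix.fromBlocks Z 0 0 W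
          * ((1 : Matrix (Fin k ⊕ Fin k) (Fin k ⊕ Fin k) ℂ)
              - Matrix.fromBlocks ((1/2 : ℂ) • Z) (-((1/2 : ℂ) • W))
                  (-((1/2 : ℂ) • Z)) ((1/2 : ℂ) • W))⁻¹
          * colII k)) ≤ 1 := by
  refine ⟨isUnit_pencil hZ hW, ContinuousLinearMap.opNorm_le_bound _ zero_le_one fun x => ?_⟩
  have hP := isUnit_pencil hZ hW
  rw [one_mul, ← WithLp.toLp_ofLp 2 x, Matrix.toEuclideanCLM_toLp]
  generalize x.ofLp = y
  rw [Matrix.smul_mulVec, ← Matrix.mulVec_mulVec, ← Matrix.mulVec_mulVec, ← Matrix.mulVec_mulVec,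
    colII_mulVec, rowII_mulVec, Matrix.fromBlocks_mulVec]
  generalize hp : (_ : Matrix (Fin k ⊕ Fin k) (Fin k ⊕ Fin k) ℂ)⁻¹ *ᵥ Sum.elim y y = p
  obtain ⟨h₁, h₂⟩ := (pencil_mulVec_eq_iff Z W p y).1 (by
    rw [← hp, Matrix.mulVec_mulVec, Matrix.mul_nonsing_inv _ ((Matrix.isUnit_iff_isUnit_det _).1 hP),
      Matrix.one_mulVec])
  simp only [Matrix.zero_mulVec, add_zero, zero_add, Sum.elim_comp_inl, Sum.elim_comp_inr]
  rw [neg_smul, WithLp.toLp_neg, norm_neg, WithLp.toLp_smul, WithLp.toLp_add]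
  apply norm_half_add_le_of_norm_le
  · rw [← WithLp.toLp_sub, ← WithLp.toLp_smul, ← WithLp.toLp_add, ← h₁]
    exact (norm_toLp_mulVec_le Z _).trans (mul_le_of_le_one_left (norm_nonneg _) hZ.le)
  · rw [← WithLp.toLp_sub, ← WithLp.toLp_smul, ← WithLp.toLp_sub, ← h₂]
    exact (norm_toLp_mulVec_le W _).trans (mul_le_of_le_one_left (norm_nonneg _) hW.le)
end

section
/- Let A₁ = [[1/2,0,0],[-1/2,0,0],[1/√2,0,0]], A₂ = [[0,-1/2,0],[0,1/2,0],[0,1/√2,0]] ∈ M₃(ℂ). Let 𝒜 be a unital Banach algebra, let n ≥ 1, and let a₁,…,aₙ, b₁,…,bₙ ∈ 𝒜 satisfy ‖aᵢ + bᵢ‖ ≤ 1 and ‖aᵢ - bᵢ‖ ≤ 1 for all i. For a word w = w₁⋯wₙ in {1,2}, let x_w = c₁⋯cₙ ∈ 𝒜 with cᵢ = aᵢ if wᵢ = 1 and cᵢ = bᵢ if wᵢ = 2, and let A^w = A_{w₁}⋯A_{wₙ}. Then for every pair of indices p, q ∈ {1,2,3}, the element Σ_{|w|=n} (A^w)_{p,q}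 · x_w of 𝒜 has norm at most √2 · 2^{-n}, where (A^w)_{p,q} ∈ ℂ is the (p,q) entry of the matrix A^w and the sum is over all words of length n. -/
open scoped Matrix

/-- For a word `w` of length `n` in the two letters `{1, 2}` (encoded as `Fin 2`, with
`0` for the letter `1` and `1` for the letter `2`), the ordered product `c₁c₂⋯cₙ` where
`cᵢ = aᵢ` if the `i`-th letter is `1` and `cᵢ = bᵢ` if it is `2`. -/
def wordElem {𝒜 : Type*} [Monoid 𝒜] {n : ℕ} (a b : Fin n → 𝒜) (w : Fin n → Fin 2) : 𝒜 :=
  (List.ofFn fun i => if w i = 0 then a i else b i).prod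

/-- Splitting off the first letter in the sum over words. -/
lemma sum_wordProd_smul_wordElem_succ {𝒜 : Type*} [NormedRing 𝒜] [NormedAlgebra ℂ 𝒜] {n : ℕ}
    (a b : Fin (n + 1) → 𝒜) (p q : Fin 3) :
    ∑ w : Fin (n + 1) → Fin 2, (wordProd ![A₁, A₂] w) p q • wordElem a b w =
      ∑ r, (A₁ p r • a 0 + A₂ p r • b 0) *
        ∑ w : Fin n → Fin 2, (wordProd ![A₁, A₂] w) r q •
          wordElem (fun i => a i.succ) (fun i => b i.succ) w := by
  rw [← (Fin.consEquiv fun _ => Fin 2).sum_comp, Fintype.sum_prod_type, Fin.sum_univ_two]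
  simp only [Fin.consEquiv, Equiv.coe_fn_mk, wordProd, wordElem, List.ofFn_succ, List.prod_cons,
    Fin.cons_zero, Fin.cons_succ, Matrix.mul_apply, Matrix.cons_val_zero, Matrix.cons_val_one,
    if_true, one_ne_zero, if_false, add_mul, Finset.mul_sum, Finset.sum_smul,
    Finset.sum_add_distrib, smul_mul_smul_comm]
  congr 1 <;> exact Finset.sum_comm

/-- The rows of the word sums: the second is the negative of the first, and the first and third
satisfy the norm bounds. -/
lemma word_sum_rows {𝒜 : Type*} [NormedRing 𝒜] [NormedAlgebra ℂ 𝒜] (n : ℕ)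
    (a b : Fin (n + 1) → 𝒜) (h1 : ∀ i, ‖a i + b i‖ ≤ 1) (h2 : ∀ i, ‖a i - b i‖ ≤ 1)
    (q : Fin 3) (S : Fin 3 → 𝒜)
    (hS : ∀ p, S p = ∑ w : Fin (n + 1) → Fin 2, (wordProd ![A₁, A₂] w) p q • wordElem a b w) :
    S 1 = -S 0 ∧ ‖S 0‖ ≤ 1 / 2 ^ (n + 1) ∧ ‖S 2‖ ≤ Real.sqrt 2 / 2 ^ (n + 1) := by
  have hsqrt : ‖(1 / (Real.sqrt 2 : ℂ))‖ = Real.sqrt 2 / 2 := by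
    rw [norm_div, norm_one, Complex.norm_real, Real.norm_of_nonneg (Real.sqrt_nonneg 2),
      Real.sqrt_div_self']
  have hhalf : ‖(1 / 2 : ℂ)‖ = 1 / 2 := by norm_num
  induction n generalizing S with
  | zero =>
    have ha : ‖a 0‖ ≤ 1 := by
      have h : a 0 = (1 / 2 : ℂ) • ((a 0 + b 0) + (a 0 - b 0)) := by module
      rw [h, norm_smul, hhalf]
      linarith [norm_add_le (a 0 + b 0) (a 0 - b 0), h1 0, h2 0]
    have hb : ‖b 0‖ ≤ 1 := by
      have h : b 0 = (1 / 2 : ℂ) • ((a 0 + b 0) - (a 0 - b 0)) := by module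
      rw [h, norm_smul, hhalf]
      linarith [norm_sub_le (a 0 + b 0) (a 0 - b 0), h1 0, h2 0]
    have hT : ∀ p, S p = A₁ p q • a 0 + A₂ p q • b 0 := by
      intro p
      rw [hS, sum_wordProd_smul_wordElem_succ]
      simp [wordProd, wordElem, Matrix.one_apply]
    have bound (c : ℂ) (r : ℝ) (hc : ‖c‖ = r) (x : 𝒜) (hx : ‖x‖ ≤ 1) : ‖c • x‖ ≤ r := by
      rw [norm_smul, hc]
      exact mul_le_of_le_one_right (hc ▸ norm_nonneg c) hx
    have hneg : ‖(-(1 / 2) : ℂ)‖ = 1 / 2 := by rw [norm_neg, hhalf]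
    simp only [hT, zero_add, pow_one]
    fin_cases q
    · refine ⟨by simp [A₁, A₂], ?_, ?_⟩
      · simpa [A₁, A₂] using bound _ _ hhalf _ ha
      · simpa [A₁, A₂] using bound _ _ hsqrt _ ha
    · refine ⟨by simp [A₁, A₂], ?_, ?_⟩
      · simpa [A₁, A₂] using bound _ _ hneg _ hb
      · simpa [A₁, A₂] using bound _ _ hsqrt _ hb
    · simp [A₁, A₂, div_nonneg]
  | succ n ih =>
    obtain ⟨R, hR⟩ : ∃ R : Fin 3 → 𝒜, ∀ p, R p = ∑ w : Fin (n + 1) → Fin 2,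
        (wordProd ![A₁, A₂] w) p q • wordElem (fun i => a i.succ) (fun i => b i.succ) w :=
      ⟨_, fun _ => rfl⟩
    obtain ⟨hrow, hfirst, -⟩ := ih (fun i => a i.succ) (fun i => b i.succ)
      (fun i => h1 i.succ) (fun i => h2 i.succ) R hR
    have hT : ∀ p, S p = ∑ r, (A₁ p r • a 0 + A₂ p r • b 0) * R r := by
      intro p
      simp only [hS, hR, sum_wordProd_smul_wordElem_succ a b]
    have e0 : S 0 = (1 / 2 : ℂ) • ((a 0 + b 0) * R 0) := by
      rw [hT, Fin.sum_univ_three, hrow]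
      simp [A₁, A₂, add_mul]
    have e1 : S 1 = -((1 / 2 : ℂ) • ((a 0 + b 0) * R 0)) := by
      rw [hT, Fin.sum_univ_three, hrow]
      simp [A₁, A₂, add_mul]
      abel
    have e2 : S 2 = (1 / (Real.sqrt 2 : ℂ)) • ((a 0 - b 0) * R 0) := by
      rw [hT, Fin.sum_univ_three, hrow]
      simp [A₁, A₂, sub_eq_add_neg, add_mul]
    have hadd : ‖(a 0 + b 0) * R 0‖ ≤ 1 / 2 ^ (n + 1) :=
      (norm_mul_le _ _).trans <| (mul_le_of_le_one_left (norm_nonneg _) (h1 0)).trans hfirst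
    have hsub : ‖(a 0 - b 0) * R 0‖ ≤ 1 / 2 ^ (n + 1) :=
      (norm_mul_le _ _).trans <| (mul_le_of_le_one_left (norm_nonneg _) (h2 0)).trans hfirst
    refine ⟨by rw [e1, e0], ?_, ?_⟩
    · rw [e0, norm_smul, hhalf]
      calc _ ≤ 1 / 2 * (1 / 2 ^ (n + 1) : ℝ) := by gcongr
        _ = _ := by ring
    · rw [e2, norm_smul, hsqrt]
      calc _ ≤ Real.sqrt 2 / 2 * (1 / 2 ^ (n + 1) : ℝ) := by gcongr
        _ = _ := by ring

/-- In a unital complex Banach algebra `𝒜`, if `‖aᵢ + bᵢ‖ ≤ 1` and `‖aᵢ - bᵢ‖ ≤ 1` for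
all `i`, then for every `n ≥ 1` and every matrix entry `(p, q)`, the element
`Σ_{|w|=n} (A^w)_{p,q} · x_w` of `𝒜` has norm at most `√2 · 2^{-n}`. -/
theorem entrywise_word_sum_norm_bound (𝒜 : Type*) [NormedRing 𝒜] [NormedAlgebra ℂ 𝒜]
    [CompleteSpace 𝒜] (n : ℕ) (hn : 1 ≤ n) (a b : Fin n → 𝒜)
    (h1 : ∀ i, ‖a i + b i‖ ≤ 1) (h2 : ∀ i, ‖a i - b i‖ ≤ 1) (p q : Fin 3) :
    ‖∑ w : Fin n → Fin 2, (wordProd ![A₁, A₂] w) p q • wordElem a b w‖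
      ≤ Real.sqrt 2 / 2 ^ n := by
  obtain ⟨m, rfl⟩ := Nat.exists_eq_add_of_le' hn
  obtain ⟨hrow, hfirst, hthird⟩ := word_sum_rows m a b h1 h2 q _ fun _ => rfl
  have hle : (1 : ℝ) / 2 ^ (m + 1) ≤ Real.sqrt 2 / 2 ^ (m + 1) := by
    gcongr
    exact Real.one_le_sqrt.mpr one_le_two
  fin_cases p
  · exact hfirst.trans hle
  · exact (congrArg norm hrow).trans (norm_neg _) |>.trans_le (hfirst.trans hle)
  · exact hthird
end
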